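/- arXiv:math/0607215 — 3 statements merged into one kernel-verified Lean document; each statement's English description precedes it below -/
import Mathlib

section
/- There exist x ∈ k and y ∈ p such that the Lie subalgebra of g generated by {x, y} is all of g. Equivalently, the set g^{K-reg} = {z ∈ g | g(z) = g} is nonempty. -/
open LieAlgebra LieModule

theorem Module.End.mem_of_sum_mem_of_apply_eq_smul {K V ι : Type*} [Field K] [AddCommGroup V]
    [Module K V] [Fintype ι] (f : Module.End K V) (S : Submodule K V) (hS : ∀ v ∈ S, f v ∈ S)
    (μ : ι → K) (v : ι → V) (hv : ∀ i, f (v i) = μ i • v i) (hsum : ∑ i, v i ∈ S)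
    (j : ι) (hj : ∀ i, i ≠ j → μ i ≠ μ j) : v j ∈ S := by
  classical
  have key (T : Finset ι) (hT : j ∉ T) :
      ∑ i, (∏ k ∈ T, (μ i - μ k)) • v i ∈ S := by
    induction T using Finset.induction_on with
    | empty => simpa using hsum
    | insert a T ha ih =>
      have h := ih (fun h ↦ hT (Finset.mem_insert_of_mem h))
      have h' := S.sub_mem (hS _ h) (S.smul_mem (μ a) h)
      convert h' using 1
      rw [map_sum, Finset.smul_sum, ← Finset.sum_sub_distrib]
      refine Finset.sum_congr rfl fun i _ ↦ ?_
      rw [Finset.prod_insert ha, map_smul, hv, smul_smul, smul_smul, ← sub_smul]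
      ring_nf
  have h := key (Finset.univ.erase j) (by simp)
  rw [Finset.sum_eq_single j] at h
  · refine (S.smul_mem_iff (Finset.prod_ne_zero_iff.mpr fun k hk ↦ ?_)).mp h
    exact sub_ne_zero.mpr (hj k (Finset.ne_of_mem_erase hk)).symm
  · intro i _ hij
    rw [Finset.prod_eq_zero (i := i) (by simp [hij]) (sub_self _), zero_smul]
  · simp

theorem LieSubalgebra.eq_top_of_forall_lie_mem {K L : Type*} [Field K] [LieRing L]
    [LieAlgebra K L] [FiniteDimensional K L] [IsKilling K L] (S : LieSubalgebra K L)
    (hS : ∀ a b : L, ⁅a, b⁆ ∈ S) : S = ⊤ := by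
  rw [← LieSubalgebra.toSubmodule_inj, LieSubalgebra.top_toSubmodule]
  by_contra hne
  have hnd := IsKilling.killingForm_nondegenerate K L
  obtain ⟨φ, hφ, hφS⟩ := S.toSubmodule.exists_le_ker_of_lt_top (lt_top_iff_ne_top.mpr hne)
  obtain ⟨v, rfl⟩ := ((killingForm K L).toDual hnd).surjective φ
  have hv (w : L) (hw : w ∈ S) : killingForm K L v w = 0 := by
    have h := hφS hw
    rwa [LinearMap.mem_ker, LinearMap.BilinForm.toDual_def] at h
  have hc : v ∈ center K L := by
    rw [LieModule.mem_maxTrivSubmodule]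
    intro a
    rw [← lie_skew, neg_eq_zero]
    refine hnd.1 _ fun b ↦ ?_
    rw [LieModule.traceForm_apply_lie_apply]
    exact hv _ (hS a b)
  rw [center_eq_bot, LieSubmodule.mem_bot] at hc
  exact hφ (by simp [hc])

theorem LieAlgebra.IsKilling.exists_root_vectors {K L : Type*} [Field K] [CharZero K]
    [IsAlgClosed K] [LieRing L]
    [LieAlgebra K L] [FiniteDimensional K L] [IsKilling K L] (H : LieSubalgebra K L)
    [H.IsCartanSubalgebra] :
    ∃ (e : H.root → L) (c : H.root → Module.Dual K L),
      (∀ (i : H.root) (h : H), ⁅(h : L), e i⁆ = i.1 h • e i) ∧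
      (∀ i, c i (e i) = 1) ∧ (∀ i, ∀ h ∈ H, c i h = 0) ∧
      (∀ v, v - ∑ i, c i v • e i ∈ H) := by
  have key (i : H.root) : ∃ e ∈ rootSpace H i.1, ∃ f ∈ rootSpace H (-i.1),
      killingForm K L f e = 1 := by
    obtain ⟨e, he, he₀⟩ := i.1.exists_ne_zero
    obtain ⟨f, hf, hf₀⟩ : ∃ f ∈ rootSpace H (-i.1), killingForm K L e f ≠ 0 := by
      contrapose! he₀
      simpa using mem_ker_killingForm_of_mem_rootSpace_of_forall_rootSpace_neg K L H he he₀
    rw [LieModule.traceForm_comm] at hf₀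
    refine ⟨e, he, (killingForm K L f e)⁻¹ • f, Submodule.smul_mem _ _ hf, ?_⟩
    simp [hf₀]
  choose e he f hf hef using key
  have hne (i : H.root) : (i.1 : H → K) ≠ 0 := H.isNonZero_coe_root i
  have horth (i : H.root) (χ : H → K) (hχ : χ ≠ i.1) (v : L) (hv : v ∈ rootSpace H χ) :
      killingForm K L (f i) v = 0 := by
    refine killingForm_apply_eq_zero_of_mem_rootSpace_of_add_ne_zero K L H (hf i) hv ?_
    intro h
    exact hχ (by rw [neg_add_eq_zero] at h; exact h.symm)
  refine ⟨e, fun i ↦ killingForm K L (f i), fun i h ↦ ?_, hef, fun i h hh ↦ ?_, fun v ↦ ?_⟩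
  · exact lie_eq_smul_of_mem_rootSpace (he i) h
  · refine horth i 0 (hne i).symm h ?_
    rwa [← LieSubalgebra.mem_toLieSubmodule, ← rootSpace_zero_eq K L H] at hh
  · have hv : v ∈ ⨆ χ : Weight K H L, rootSpace H χ := by simp [iSup_genWeightSpace_eq_top']
    induction hv using LieSubmodule.iSup_induction' with
    | zero => simp
    | add v w _ _ hv hw =>
      convert H.add_mem hv hw using 1
      simp only [map_add, add_smul, Finset.sum_add_distrib]
      abel
    | mem χ v hv =>
      by_cases hχ : χ.IsZero
      · have hχ' : (χ : H → K) = 0 := hχ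
        rw [Finset.sum_eq_zero, sub_zero]
        · rw [hχ'] at hv
          rwa [← LieSubalgebra.mem_toLieSubmodule, ← rootSpace_zero_eq K L H]
        · intro i _
          rw [horth i χ (by rw [hχ']; exact (hne i).symm) v hv, zero_smul]
      · let j : H.root := ⟨χ, by simpa using hχ⟩
        rw [Finset.sum_eq_single j]
        · have he₀ : e j ≠ 0 := by
            intro h
            have := hef j
            simp [h] at this
          obtain ⟨r, hr⟩ := (finrank_eq_one_iff_of_nonzero' (⟨e j, he j⟩ : rootSpace H χ)
            (by simpa [Subtype.ext_iff] using he₀)).mp (finrank_rootSpace_eq_one χ hχ) ⟨v, hv⟩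
          have hr' : r • e j = v := congrArg Subtype.val hr
          rw [← hr', map_smul, hef]
          simp
        · intro i _ hij
          rw [horth i χ (fun h ↦ hij (Subtype.ext (DFunLike.coe_injective h.symm))) v hv, zero_smul]
        · simp

theorem LieModule.Weight.apply_eq_zero_of_eq_lie {K L : Type*} [Field K] [CharZero K]
    [LieRing L] [LieAlgebra K L] [FiniteDimensional K L]
    (N : LieSubalgebra K L) [LieRing.IsNilpotent N] (χ : Weight K N L) {a b : L}
    (ha : a ∈ rootSpace N 0) (hb : b ∈ rootSpace N 0) (c : N) (hc : (c : L) = ⁅a, b⁆) :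
    χ c = 0 := by
  let W : Submodule K L := (genWeightSpace L χ).toSubmodule
  have hW {u : L} (hu : u ∈ rootSpace N 0) : ∀ m ∈ W, ad K L u m ∈ W := fun m hm ↦ by
    have h := lie_mem_genWeightSpace_of_mem_genWeightSpace hu hm
    rwa [zero_add] at h
  let A : Module.End K W := (ad K L a).restrict (hW ha)
  let B : Module.End K W := (ad K L b).restrict (hW hb)
  have hAB : toEnd K N (genWeightSpace L χ) c = A * B - B * A := by
    ext m
    change ⁅(c : L), (m : L)⁆ = ⁅a, ⁅b, (m : L)⁆⁆ - ⁅b, ⁅a, (m : L)⁆⁆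
    rw [hc, lie_lie]
  have htr : LinearMap.trace K (genWeightSpace L χ) (toEnd K N (genWeightSpace L χ) c) = 0 := by
    rw [hAB]
    change LinearMap.trace K W (A * B - B * A) = 0
    rw [map_sub, LinearMap.trace_mul_comm, sub_self]
  rw [trace_toEnd_genWeightSpace, smul_eq_zero] at htr
  refine htr.resolve_left fun h ↦ χ.genWeightSpace_ne_bot L ?_
  rw [← LieSubmodule.toSubmodule_eq_bot]
  exact Submodule.finrank_eq_zero.mp h

section Involution

variable {K L : Type*} [Field K] [LieRing L] [LieAlgebra K L]
  {θ : L →ₗ⁅K⁆ L}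

theorem LieHom.exists_eq_add_of_involutive [CharZero K] (hθ : ∀ v, θ (θ v) = v) (v : L) :
    ∃ a b, θ a = a ∧ θ b = -b ∧ v = a + b := by
  refine ⟨(2⁻¹ : K) • (v + θ v), (2⁻¹ : K) • (v - θ v), ?_, ?_, ?_⟩
  · rw [map_smul, map_add, hθ, add_comm]
  · rw [map_smul, map_sub, hθ, ← smul_neg, neg_sub]
  · rw [← smul_add, add_add_sub_cancel, ← two_smul K v, smul_smul]
    simp

theorem LieHom.killingForm_apply_of_involutive (hθ : ∀ v, θ (θ v) = v) (v w : L) :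
    killingForm K L (θ v) (θ w) = killingForm K L v w :=
  killingForm_of_equiv_apply { θ with invFun := θ, left_inv := hθ, right_inv := hθ } v w

theorem LieHom.killingForm_eq_zero_of_involutive [CharZero K] (hθ : ∀ v, θ (θ v) = v) {v w : L}
    (hv : θ v = v) (hw : θ w = -w) : killingForm K L v w = 0 := by
  have h := killingForm_apply_of_involutive hθ v w
  rw [hv, hw, map_neg] at h
  exact self_eq_neg.mp h.symm

theorem LieHom.apply_ad_pow_of_apply_eq {x : L} (hx : θ x = x) (n : ℕ) (v : L) :
    θ ((ad K L x ^ n) v) = (ad K L x ^ n) (θ v) := by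
  induction n generalizing v with
  | zero => simp
  | succ n ih => rw [pow_succ, Module.End.mul_apply, Module.End.mul_apply, ih]; simp [hx]

theorem LieHom.apply_mem_engel_of_apply_eq {x v : L} (hx : θ x = x)
    (hv : v ∈ LieSubalgebra.engel K x) : θ v ∈ LieSubalgebra.engel K x := by
  rw [LieSubalgebra.mem_engel_iff] at hv ⊢
  obtain ⟨n, hn⟩ := hv
  exact ⟨n, by rw [← apply_ad_pow_of_apply_eq hx, hn, map_zero]⟩

theorem LieHom.exists_mem_engel_eq_add_of_involutive [CharZero K] (hθ : ∀ v, θ (θ v) = v) {x v : L}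
    (hx : θ x = x) (hv : v ∈ LieSubalgebra.engel K x) :
    ∃ a ∈ LieSubalgebra.engel K x, ∃ b ∈ LieSubalgebra.engel K x,
      θ a = a ∧ θ b = -b ∧ v = a + b := by
  obtain ⟨a, b, ha, hb, rfl⟩ := exists_eq_add_of_involutive hθ v
  have h := LieHom.apply_mem_engel_of_apply_eq hx hv
  rw [map_add, ha, hb] at h
  have ha' : a ∈ LieSubalgebra.engel K x := by
    have h2 := (LieSubalgebra.engel K x).smul_mem (2⁻¹ : K)
      ((LieSubalgebra.engel K x).add_mem hv h)
    convert h2 using 1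
    rw [add_add_add_comm, add_neg_cancel, add_zero, ← two_smul K a, smul_smul]
    simp
  refine ⟨a, ha', b, ?_, ha, hb, rfl⟩
  simpa using (LieSubalgebra.engel K x).sub_mem hv ha'

theorem LieSubalgebra.killingForm_ad_pow (x : L) (n : ℕ) (v w : L) :
    killingForm K L v ((ad K L x ^ n) w) = (-1) ^ n * killingForm K L ((ad K L x ^ n) v) w := by
  induction n generalizing v with
  | zero => simp
  | succ n ih =>
    rw [pow_succ', Module.End.mul_apply, ad_apply, ← traceForm_apply_lie_apply, ← lie_skew,
      map_neg, LinearMap.neg_apply, ih, ← ad_apply (R := K), ← Module.End.mul_apply, ← pow_succ,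
      ← pow_succ']
    ring

/-- The Killing form is nondegenerate on the fixed points of an involution in an Engel subalgebra
of a fixed point. -/
theorem LieHom.eq_zero_of_forall_mem_engel_killingForm_eq_zero [CharZero K]
    [FiniteDimensional K L] [IsKilling K L] (hθ : ∀ v, θ (θ v) = v) {x u : L} (hx : θ x = x) (hu : θ u = u)
    (hux : u ∈ LieSubalgebra.engel K x)
    (h : ∀ c ∈ LieSubalgebra.engel K x, θ c = c → killingForm K L u c = 0) : u = 0 := by
  refine (IsKilling.killingForm_nondegenerate K L).1 u fun w ↦ ?_
  obtain ⟨m, hm⟩ := (LieSubalgebra.mem_engel_iff K x u).mp hux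
  obtain ⟨n, hn⟩ := Filter.eventually_atTop.mp
    (LinearMap.eventually_isCompl_ker_pow_range_pow (ad K L x))
  have hw : w ∈ LinearMap.ker (ad K L x ^ (n + m)) ⊔ LinearMap.range (ad K L x ^ (n + m)) := by
    rw [(hn (n + m) (Nat.le_add_right n m)).sup_eq_top]
    trivial
  obtain ⟨w₀, hw₀, _, ⟨w₁, rfl⟩, rfl⟩ := Submodule.mem_sup.mp hw
  obtain ⟨a, ha, b, hb, hθa, hθb, rfl⟩ := exists_mem_engel_eq_add_of_involutive hθ hx
    ((LieSubalgebra.mem_engel_iff K x w₀).mpr ⟨n + m, hw₀⟩)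
  rw [map_add, map_add, h a ha hθa, killingForm_eq_zero_of_involutive hθ hu hθb,
    LieSubalgebra.killingForm_ad_pow, pow_add (ad K L x), Module.End.mul_apply, hm]
  simp

/-- The elements of an Engel subalgebra fixed by an endomorphism. -/
def LieHom.fixedEngel (θ : L →ₗ⁅K⁆ L) (x : L) : LieSubalgebra K L :=
  LieSubalgebra.engel K x ⊓
    { LinearMap.eqLocus (θ : L →ₗ[K] L) LinearMap.id with
      lie_mem' := fun {a b} ha hb ↦ by
        have ha' : θ a = a := ha
        have hb' : θ b = b := hb
        change θ ⁅a, b⁆ = ⁅a, b⁆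
        rw [map_lie, ha', hb'] }

theorem LieHom.mem_fixedEngel {x v : L} :
    v ∈ θ.fixedEngel x ↔ v ∈ LieSubalgebra.engel K x ∧ θ v = v := Iff.rfl

theorem LieHom.isNilpotent_engel_of_forall_le [CharZero K] [IsAlgClosed K]
    [FiniteDimensional K L]
    [IsKilling K L] (hθ : ∀ v, θ (θ v) = v) {x : L} (hx : θ x = x)
    (hmin : ∀ u ∈ θ.fixedEngel x, LieSubalgebra.engel K x ≤ LieSubalgebra.engel K u) :
    LieRing.IsNilpotent (LieSubalgebra.engel K x) := by
  set E := LieSubalgebra.engel K x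
  set N := θ.fixedEngel x
  have hN : LieRing.IsNilpotent N := N.isNilpotent_of_forall_le_engel
    fun u hu v hv ↦ hmin u hu hv.1
  have hroot : ∀ a ∈ E, a ∈ rootSpace N 0 := fun a ha ↦ by
    rw [mem_genWeightSpace]
    intro u
    obtain ⟨n, hn⟩ := (LieSubalgebra.mem_engel_iff K (u : L) a).mp (hmin u u.2 ha)
    refine ⟨n, ?_⟩
    simpa using! hn
  have hzero {a b : L} (ha : a ∈ E) (hb : b ∈ E) (h : θ ⁅a, b⁆ = ⁅a, b⁆) : ⁅a, b⁆ = 0 := by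
    have hc : ⁅a, b⁆ ∈ N := ⟨E.lie_mem ha hb, h⟩
    refine eq_zero_of_forall_mem_engel_killingForm_eq_zero hθ hx h hc.1 fun u hu hθu ↦ ?_
    have htr := traceForm_eq_sum_finrank_nsmul_mul K N L ⟨_, hc⟩ ⟨u, hu, hθu⟩
    rw [Finset.sum_eq_zero] at htr
    · exact htr
    · intro χ _
      rw [χ.apply_eq_zero_of_eq_lie N (hroot a ha) (hroot b hb) ⟨_, hc⟩ rfl]
      simp
  refine E.isNilpotent_of_forall_le_engel fun v hv w hw ↦ ?_
  obtain ⟨a, ha, b, hb, hθa, hθb, rfl⟩ := exists_mem_engel_eq_add_of_involutive hθ hx hv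
  obtain ⟨c, hc, d, hd, hθc, hθd, rfl⟩ := exists_mem_engel_eq_add_of_involutive hθ hx hw
  have hodd {q : L} (hq : q ∈ E) (hθq : θ q = -q) (n : ℕ) :
      (ad K L (a + b) ^ n) q = (ad K L a ^ n) q := by
    induction n generalizing q with
    | zero => simp
    | succ n ih =>
      have h0 : ⁅b, q⁆ = 0 := hzero hb hq (by simp [hθb, hθq])
      rw [pow_succ, pow_succ, Module.End.mul_apply, Module.End.mul_apply, ad_apply, ad_apply,
        add_lie, h0, add_zero, ih (E.lie_mem ha hq) (by simp [hθa, hθq])]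
  have hac : ⁅a, c⁆ = 0 := hzero ha hc (by simp [hθa, hθc])
  have hbd : ⁅b, d⁆ = 0 := hzero hb hd (by simp [hθb, hθd])
  have hq : ⁅a, d⁆ + ⁅b, c⁆ ∈ E := E.add_mem (E.lie_mem ha hd) (E.lie_mem hb hc)
  obtain ⟨n, hn⟩ := (LieSubalgebra.mem_engel_iff K a _).mp (hmin a ⟨ha, hθa⟩ hq)
  refine (LieSubalgebra.mem_engel_iff K _ _).mpr ⟨n + 1, ?_⟩
  have : ⁅a + b, c + d⁆ = ⁅a, d⁆ + ⁅b, c⁆ := by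
    rw [add_lie, lie_add, lie_add, hac, hbd, zero_add, add_zero]
  rw [pow_succ, Module.End.mul_apply, ad_apply, this, hodd hq, hn]
  simp [hθa, hθb, hθc, hθd, add_comm]

/-- Some fixed point of an involution of a Lie algebra with nondegenerate Killing form has a Cartan
subalgebra as its Engel subalgebra. -/
theorem LieHom.exists_isCartanSubalgebra_engel_of_involutive [CharZero K] [IsAlgClosed K]
    [FiniteDimensional K L] [IsKilling K L] (hθ : ∀ v, θ (θ v) = v) :
    ∃ x, θ x = x ∧ (LieSubalgebra.engel K x).IsCartanSubalgebra := by
  obtain ⟨x, hx, hmin⟩ := exists_minimalFor_of_wellFoundedLT (fun x : L ↦ θ x = x)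
    (fun x ↦ Module.finrank K (LieSubalgebra.engel K x)) ⟨0, map_zero θ⟩
  refine ⟨x, hx, ?_, LieSubalgebra.normalizer_engel K x⟩
  refine isNilpotent_engel_of_forall_le hθ hx fun u hu ↦ ?_
  have := IsAlgClosed.instInfinite (K := K)
  refine LieAlgebra.engel_isBot_of_isMin
    ((Cardinal.natCast_le_aleph0).trans (Cardinal.infinite_iff.mp inferInstance))
    (θ.fixedEngel x) ⟨_, x, ⟨LieSubalgebra.self_mem_engel K x, hx⟩, rfl⟩ (fun v hv ↦ hv.1) ?_
    ⟨_, u, hu, rfl⟩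
  rintro ⟨_, w, hw, rfl⟩ hle
  have hle' : LieSubalgebra.engel K w ≤ LieSubalgebra.engel K x := hle
  have hfin := hmin hw.2 (Submodule.finrank_mono hle')
  change LieSubalgebra.engel K x ≤ LieSubalgebra.engel K w
  exact (Submodule.eq_of_le_of_finrank_le hle' hfin).ge

end Involution

section Generic

variable {K L : Type*} [Field K] [CharZero K] [IsAlgClosed K] [LieRing L] [LieAlgebra K L]
  [FiniteDimensional K L] {θ : L →ₗ⁅K⁆ L}

/-- A generic pair consisting of a fixed point and an anti-fixed point of the involution `θ`,
relative to a `θ`-stable Cartan subalgebra with root vectors `e` and root coordinates `c`. -/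
theorem LieHom.exists_generic_pair_of_involutive (hθ : ∀ v, θ (θ v) = v) {x₀ : L}
    (hx₀ : θ x₀ = x₀) [(LieSubalgebra.engel K x₀).IsCartanSubalgebra]
    {e : (LieSubalgebra.engel K x₀).root → L}
    {c : (LieSubalgebra.engel K x₀).root → Module.Dual K L}
    (he : ∀ i (h : LieSubalgebra.engel K x₀), ⁅(h : L), e i⁆ = i.1 h • e i)
    (hce : ∀ i, c i (e i) = 1) (hc : ∀ i, ∀ h ∈ LieSubalgebra.engel K x₀, c i h = 0)
    (hdecomp : ∀ v, v - ∑ i, c i v • e i ∈ LieSubalgebra.engel K x₀) :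
    ∃ x y : LieSubalgebra.engel K x₀, ∃ w : L, θ x = x ∧ θ w = -w ∧
      (y : L) = w - ∑ i, c i w • e i ∧ (∀ i : (LieSubalgebra.engel K x₀).root, i.1 x ≠ 0) ∧
      (∀ i j : (LieSubalgebra.engel K x₀).root, i ≠ j → i.1 (x + y) ≠ j.1 (x + y)) ∧
      ∀ i p, θ p = -p → c i p ≠ 0 → c i w ≠ 0 := by
  set H := LieSubalgebra.engel K x₀
  have : Infinite K := IsAlgClosed.instInfinite
  let π : L →ₗ[K] H := LinearMap.codRestrict H.toSubmodule
    (LinearMap.id - ∑ i, (c i).smulRight (e i)) (fun v ↦ by simpa using hdecomp v)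
  have hπ (v : L) : (π v : L) = v - ∑ i, c i v • e i := by
    change (LinearMap.id - ∑ i, (c i).smulRight (e i) : L →ₗ[K] L) v = _
    simp only [LinearMap.sub_apply, LinearMap.sum_apply, LinearMap.smulRight_apply,
      LinearMap.id_apply]
  have hπH (h : H) : π h = h := by
    ext
    rw [hπ, Finset.sum_eq_zero (fun i _ ↦ by rw [hc i h h.2, zero_smul]), sub_zero]
  let V : Submodule K (H × L) :=
    { carrier := {q | θ q.1 = q.1 ∧ θ q.2 = -q.2}
      zero_mem' := by simp
      add_mem' := fun {a b} ha hb ↦ by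
        simp only [Set.mem_ofPred_eq] at ha hb
        simp [ha, hb, add_comm]
      smul_mem' := fun r a ha ↦ by
        simp only [Set.mem_ofPred_eq] at ha
        simp [ha] }
  let I := H.root ⊕ {q : H.root × H.root // q.1 ≠ q.2} ⊕ {i : H.root // ∃ p, θ p = -p ∧ c i p ≠ 0}
  let F : I → Module.Dual K (H × L) := Sum.elim
    (fun i ↦ (Weight.toLinear K H L i.1) ∘ₗ LinearMap.fst K H L)
    (Sum.elim
      (fun q ↦ (Weight.toLinear K H L q.1.1 - Weight.toLinear K H L q.1.2) ∘ₗ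
        (LinearMap.fst K H L + π ∘ₗ LinearMap.snd K H L))
      (fun i ↦ c i ∘ₗ LinearMap.snd K H L))
  obtain ⟨⟨x, w⟩, ⟨hx, hw⟩, hF⟩ :=
      Module.Dual.exists_forall_mem_ne_zero_of_forall_exists V F (by
    rintro (i | ⟨⟨i, j⟩, hij⟩ | ⟨i, p, hp, hip⟩)
    · refine ⟨(⟨x₀, LieSubalgebra.self_mem_engel K x₀⟩, 0), ⟨hx₀, by simp⟩, fun h ↦ ?_⟩
      have h' : i.1 ⟨x₀, LieSubalgebra.self_mem_engel K x₀⟩ = 0 := h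
      have h0 := he i ⟨x₀, LieSubalgebra.self_mem_engel K x₀⟩
      rw [h', zero_smul] at h0
      have : e i ∈ H := (LieSubalgebra.mem_engel_iff K x₀ _).mpr ⟨1, by simpa using h0⟩
      exact one_ne_zero ((hce i).symm.trans (hc i _ this))
    · have : Weight.toLinear K H L i.1 - Weight.toLinear K H L j.1 ≠ 0 := fun h ↦
        hij (Subtype.ext (DFunLike.coe_injective
          (congrArg (fun f : H →ₗ[K] K ↦ (f : H → K)) (sub_eq_zero.mp h))))
      obtain ⟨⟨h, hh⟩, hne⟩ := DFunLike.ne_iff.mp this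
      obtain ⟨a, ha, b, hb, hθa, hθb, rfl⟩ :=
        exists_mem_engel_eq_add_of_involutive hθ hx₀ hh
      refine ⟨(⟨a, ha⟩, b), ⟨hθa, hθb⟩, ?_⟩
      have h2 : π b = ⟨b, hb⟩ := hπH ⟨b, hb⟩
      change (Weight.toLinear K H L i.1 - Weight.toLinear K H L j.1) (⟨a, ha⟩ + π b) ≠ 0
      rw [h2]
      exact hne
    · exact ⟨(0, p), ⟨by simp, hp⟩, hip⟩)
  refine ⟨x, π w, w, hx, hw, hπ w, fun i ↦ hF (Sum.inl i), fun i j hij h ↦ ?_,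
    fun i p hp hip ↦ hF (Sum.inr (Sum.inr ⟨i, p, hp, hip⟩))⟩
  exact hF (Sum.inr (Sum.inl ⟨(i, j), hij⟩)) (sub_eq_zero.mpr h)

theorem LieHom.exists_lieSpan_pair_eq_top_of_involutive [IsKilling K L] (hθ : ∀ v, θ (θ v) = v)
    (hproper : ∀ v, θ v = v →
      v ∈ Submodule.span K {u : L | ∃ a b, θ a = -a ∧ θ b = -b ∧ u = ⁅a, b⁆}) :
    ∃ x y, θ x = x ∧ θ y = -y ∧ LieSubalgebra.lieSpan K L {x, y} = ⊤ := by
  obtain ⟨x₀, hx₀, hH⟩ := exists_isCartanSubalgebra_engel_of_involutive hθ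
  set H := LieSubalgebra.engel K x₀
  obtain ⟨e, c, he, hce, hc, hdecomp⟩ := IsKilling.exists_root_vectors H
  obtain ⟨x, y, w, hx, hw, hy, hne, hinj, hcw⟩ :=
    exists_generic_pair_of_involutive hθ hx₀ he hce hc hdecomp
  refine ⟨x, w, hx, hw, ?_⟩
  set S := LieSubalgebra.lieSpan K L {(x : L), w}
  have hxS : (x : L) ∈ S := LieSubalgebra.subset_lieSpan (by simp)
  have hwS : w ∈ S := LieSubalgebra.subset_lieSpan (by simp)
  have hHH (a b : L) (ha : a ∈ H) (hb : b ∈ H) : ⁅a, b⁆ = 0 :=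
    congrArg Subtype.val (trivial_lie_zero H H ⟨a, ha⟩ ⟨b, hb⟩)
  have hyS : (y : L) ∈ S := by
    refine Module.End.mem_of_sum_mem_of_apply_eq_smul (ad K L (x : L)) S.toSubmodule
      (fun v hv ↦ S.lie_mem hxS hv) (fun o : Option H.root ↦ o.elim 0 (fun i ↦ i.1 x))
      (fun o : Option H.root ↦ o.elim (y : L) (fun i ↦ c i w • e i)) ?_ ?_ none ?_
    · rintro (_ | i)
      · simpa using! hHH x y x.2 y.2
      · change ⁅(x : L), c i w • e i⁆ = i.1 x • c i w • e i
        rw [lie_smul, he, smul_comm]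
    · rw [Fintype.sum_option]
      change (y : L) + ∑ i, c i w • e i ∈ S
      rwa [hy, sub_add_cancel]
    · rintro (_ | i) hi
      · exact absurd rfl hi
      · exact hne i
  have heS (i : H.root) (hi : c i w ≠ 0) : e i ∈ S := by
    rw [← LieSubalgebra.mem_toSubmodule, ← S.toSubmodule.smul_mem_iff hi]
    refine Module.End.mem_of_sum_mem_of_apply_eq_smul (ad K L ((x + y : H) : L)) S.toSubmodule
      (fun v hv ↦ S.lie_mem (S.add_mem hxS hyS) hv) (fun i : H.root ↦ i.1 (x + y))
      (fun i ↦ c i w • e i) (fun i ↦ ?_) ?_ i (fun j hj ↦ hinj j i hj)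
    · rw [ad_apply, lie_smul, he, smul_comm]
    · have h := S.sub_mem hwS hyS
      rwa [hy, sub_sub_cancel] at h
  have hHS (h : L) (hh : h ∈ H) (v : L) (hv : v ∈ S) : ⁅h, v⁆ ∈ S := by
    induction hv using LieSubalgebra.lieSpan_induction with
    | mem v hv =>
      obtain rfl | rfl := hv
      · rw [hHH h x hh x.2]
        exact S.zero_mem
      · have hv : v = y + ∑ i, c i v • e i := by rw [hy, sub_add_cancel]
        rw [hv, lie_add, hHH h y hh y.2, zero_add, lie_sum]
        refine sum_mem fun i _ ↦ ?_
        rw [lie_smul, he i ⟨h, hh⟩]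
        by_cases hi : c i v = 0
        · rw [hi, zero_smul]
          exact S.zero_mem
        · exact S.smul_mem _ (S.smul_mem _ (heS i hi))
    | zero => rw [lie_zero]; exact S.zero_mem
    | add u v _ _ hu hv => rw [lie_add]; exact S.add_mem hu hv
    | smul r v _ hv => rw [lie_smul]; exact S.smul_mem r hv
    | lie u v hu hv hu' hv' =>
      rw [leibniz_lie]
      exact S.add_mem (S.lie_mem hu' hv) (S.lie_mem hu hv')
  have hodd (p : L) (hp : θ p = -p) : ∃ h ∈ H, ∃ s ∈ S, p = h + s := by
    refine ⟨_, hdecomp p, ∑ i, c i p • e i, sum_mem fun i _ ↦ ?_, by rw [sub_add_cancel]⟩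
    by_cases hi : c i p = 0
    · rw [hi, zero_smul]
      exact S.zero_mem
    · exact S.smul_mem _ (heS i (hcw i p hp hi))
  have hlie {h s h' s' : L} (hh : h ∈ H) (hs : s ∈ S) (hh' : h' ∈ H) (hs' : s' ∈ S) :
      ⁅h + s, h' + s'⁆ ∈ S := by
    rw [add_lie, lie_add, lie_add, hHH h h' hh hh', zero_add, ← lie_skew s h']
    exact S.add_mem (hHS h hh s' hs')
      (S.add_mem (S.neg_mem (hHS h' hh' s hs)) (S.lie_mem hs hs'))
  have heven (v : L) (hv : θ v = v) : v ∈ S := by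
    refine (Submodule.span_le (p := S.toSubmodule)).mpr ?_ (hproper v hv)
    rintro _ ⟨a, b, ha, hb, rfl⟩
    obtain ⟨h, hh, s, hs, rfl⟩ := hodd a ha
    obtain ⟨h', hh', s', hs', rfl⟩ := hodd b hb
    exact hlie hh hs hh' hs'
  have hall (v : L) : ∃ h ∈ H, ∃ s ∈ S, v = h + s := by
    obtain ⟨a, b, ha, hb, rfl⟩ := exists_eq_add_of_involutive hθ v
    obtain ⟨h, hh, s, hs, rfl⟩ := hodd b hb
    exact ⟨h, hh, a + s, S.add_mem (heven a ha) hs, add_left_comm a h s⟩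
  refine S.eq_top_of_forall_lie_mem fun a b ↦ ?_
  obtain ⟨h, hh, s, hs, rfl⟩ := hall a
  obtain ⟨h', hh', s', hs', rfl⟩ := hall b
  exact hlie hh hs hh' hs'

end Generic

theorem stmt11 {g : Type} [LieRing g] [LieAlgebra ℂ g] [FiniteDimensional ℂ g]
    [LieAlgebra.IsSemisimple ℂ g]
    (θ : g →ₗ⁅ℂ⁆ g) (hθinv : ∀ v, θ (θ v) = v)
    (hproper : ∀ v : g, θ v = v ↔
      v ∈ Submodule.span ℂ {u : g | ∃ a b : g, θ a = -a ∧ θ b = -b ∧ u = ⁅a, b⁆}) :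
    ∃ x y : g, θ x = x ∧ θ y = -y ∧ LieSubalgebra.lieSpan ℂ g {x, y} = ⊤ := by
  exact LieHom.exists_lieSpan_pair_eq_top_of_involutive hθinv fun v ↦ (hproper v).mp
end

section
/- Assume g has trivial center. Let z = x + y with x ∈ k, y ∈ p and suppose the Lie subalgebra of g generated by {x, y} is all of g. Then the only v ∈ k with [v, z] = 0 is v = 0. -/
theorem stmt13 {g : Type} [LieRing g] [LieAlgebra ℂ g] [FiniteDimensional ℂ g]
    (hcenter : LieAlgebra.center ℂ g = ⊥)
    (k p : Submodule ℂ g) (hcompl : IsCompl k p)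
    (hkk : ∀ a ∈ k, ∀ b ∈ k, ⁅a, b⁆ ∈ k)
    (hkp : ∀ a ∈ k, ∀ b ∈ p, ⁅a, b⁆ ∈ p)
    (hpp : ∀ a ∈ p, ∀ b ∈ p, ⁅a, b⁆ ∈ k)
    (x y z : g) (hx : x ∈ k) (hy : y ∈ p) (hz : z = x + y)
    (hgen : LieSubalgebra.lieSpan ℂ g {x, y} = ⊤) :
    ∀ v ∈ k, ⁅v, z⁆ = 0 → v = 0 := by
  intro v hv hvz
  have hsum : ⁅v, x⁆ + ⁅v, y⁆ = 0 := by rw [← lie_add, ← hz, hvz]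
  have hvx : ⁅v, x⁆ = 0 := by
    refine Submodule.disjoint_def.mp hcompl.disjoint _ (hkk v hv x hx) ?_
    rw [eq_neg_of_add_eq_zero_left hsum]
    exact p.neg_mem (hkp v hv y hy)
  have hvy : ⁅v, y⁆ = 0 := by simpa [hvx] using hsum
  have hcomm : ∀ w : g, ⁅v, w⁆ = 0 := by
    intro w
    have hw : w ∈ LieSubalgebra.lieSpan ℂ g {x, y} := hgen ▸ LieSubalgebra.mem_top w
    induction hw using LieSubalgebra.lieSpan_induction with
    | mem u hu => rcases hu with rfl | rfl <;> assumption
    | zero => exact lie_zero v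
    | add a b _ _ ha hb => rw [lie_add, ha, hb, add_zero]
    | smul c a _ ha => rw [lie_smul, ha, smul_zero]
    | lie a b _ _ ha hb => rw [leibniz_lie, ha, hb, zero_lie, lie_zero, add_zero]
  have hmem : v ∈ LieAlgebra.center ℂ g := by
    refine (LieModule.mem_maxTrivSubmodule ℂ g g v).mpr fun w => ?_
    rw [← lie_skew, hcomm, neg_zero]
  rwa [hcenter, LieSubmodule.mem_bot] at hmem
end

section
/- Let z = x + y and z' = x' + y' with x, x' ∈ k and y, y' ∈ p, and let ξ_z (resp. ξ_{z'}) be the unique Lie algebra homomorphism from the free Lie algebra on two generators X, Y to g sending X ↦ x, Y ↦ y (resp. X ↦ x', Y ↦ y'). Assume ξ_z is surjective (i.e. x and y generate g) and assume that for every element T of the free Lie algebra, ξ_z(T) = 0 if and only if ξ_{z'}(T) = 0. Then there exists a Lie algebra automorphism π of g such that π ∘ ξ_z = ξ_{z'} (in particular π(x) = x' and π(y) = y'), and π maps k onto k and p onto p. -/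
/-- Two Lie algebra homomorphisms `f f' : F → L` with the same kernel, the first one surjective onto
a finite-dimensional Lie algebra, differ by an automorphism of `L`. -/
theorem LieHom.exists_lieEquiv_apply_eq_of_ker_eq {K F L : Type*} [Field K] [LieRing F]
    [LieAlgebra K F] [LieRing L] [LieAlgebra K L] [FiniteDimensional K L] (f f' : F →ₗ⁅K⁆ L)
    (hf : Function.Surjective f) (hker : ∀ T, f T = 0 ↔ f' T = 0) :
    ∃ π : L ≃ₗ⁅K⁆ L, ∀ T, π (f T) = f' T := by
  have hff' (S T : F) : f S = f T ↔ f' S = f' T := by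
    rw [← sub_eq_zero, ← map_sub, hker, map_sub, sub_eq_zero]
  obtain ⟨s, hs⟩ := hf.hasRightInverse
  have key (T : F) : f' (s (f T)) = f' T := (hff' _ _).1 (hs _)
  let π : L →ₗ⁅K⁆ L :=
    { toFun := fun v => f' (s v)
      map_add' := fun v w => by
        rw [← map_add, ← hff', map_add, hs, hs, hs]
      map_smul' := fun c v => by
        rw [RingHom.id_apply, ← map_smul, ← hff', map_smul, hs, hs]
      map_lie' := fun {v w} => by
        rw [← LieHom.map_lie, ← hff', LieHom.map_lie, hs, hs, hs] }
  have hinj : Function.Injective π := fun v w h => by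
    rw [← hs v, ← hs w]
    exact (hff' _ _).2 h
  have hsurj : Function.Surjective π :=
    LinearMap.surjective_of_injective (f := (π : L →ₗ[K] L)) hinj
  exact ⟨LieEquiv.ofBijective π ⟨hinj, hsurj⟩, key⟩

/-- If an endomorphism `θ` fixes `x` and negates `y`, then applying `θ` after the evaluation of the
free Lie algebra at `(x, y)` amounts to first negating the second generator. -/
theorem FreeLieAlgebra.apply_lift_eq_lift_negate {R L : Type*} [CommRing R] [LieRing L]
    [LieAlgebra R L] (θ : L →ₗ⁅R⁆ L) {x y : L} (hx : θ x = x) (hy : θ y = -y)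
    (T : FreeLieAlgebra R Bool) :
    θ (lift R (fun t : Bool => if t then y else x) T) =
      lift R (fun t : Bool => if t then y else x)
        (lift R (fun t : Bool => if t then -of R true else of R false) T) := by
  rw [← LieHom.comp_apply, ← LieHom.comp_apply]
  congr 1
  ext t
  cases t <;> simp [hx, hy]

/-- A bijection commuting with `θ` and with `σ` preserves the locus where `θ` and `σ` agree. -/
theorem Equiv.image_setOf_apply_eq {α : Type*} (π : α ≃ α) (θ σ : α → α)
    (hθ : ∀ v, π (θ v) = θ (π v)) (hσ : ∀ v, π (σ v) = σ (π v)) :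
    π '' {v | θ v = σ v} = {v | θ v = σ v} := by
  ext w
  obtain ⟨v, rfl⟩ := π.surjective w
  rw [π.injective.mem_set_image, Set.mem_ofPred_eq, Set.mem_ofPred_eq, ← hθ, ← hσ,
    π.apply_eq_iff_eq]


theorem stmt14 {g : Type} [LieRing g] [LieAlgebra ℂ g] [FiniteDimensional ℂ g]
    [LieAlgebra.IsSemisimple ℂ g]
    (θ : g →ₗ⁅ℂ⁆ g) (hθinv : ∀ v, θ (θ v) = v)
    (x y x' y' : g) (hx : θ x = x) (hy : θ y = -y)
    (hx' : θ x' = x') (hy' : θ y' = -y')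
    (ξ ξ' : FreeLieAlgebra ℂ Bool →ₗ⁅ℂ⁆ g)
    (hξ : ξ = FreeLieAlgebra.lift ℂ (fun t : Bool => if t then y else x))
    (hξ' : ξ' = FreeLieAlgebra.lift ℂ (fun t : Bool => if t then y' else x'))
    (hsurj : Function.Surjective ξ)
    (hker : ∀ T : FreeLieAlgebra ℂ Bool, ξ T = 0 ↔ ξ' T = 0) :
    ∃ π : g ≃ₗ⁅ℂ⁆ g, (∀ T : FreeLieAlgebra ℂ Bool, π (ξ T) = ξ' T) ∧
      (⇑π '' {v : g | θ v = v} = {v : g | θ v = v}) ∧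
      (⇑π '' {v : g | θ v = -v} = {v : g | θ v = -v}) := by
  subst hξ hξ'
  obtain ⟨π, hπ⟩ := LieHom.exists_lieEquiv_apply_eq_of_ker_eq _ _ hsurj hker
  have hθ (v : g) : π (θ v) = θ (π v) := by
    obtain ⟨T, rfl⟩ := hsurj v
    rw [FreeLieAlgebra.apply_lift_eq_lift_negate θ hx hy, hπ, hπ,
      FreeLieAlgebra.apply_lift_eq_lift_negate θ hx' hy']
  exact ⟨π, hπ, π.toLinearEquiv.toEquiv.image_setOf_apply_eq θ id hθ fun _ => rfl,
    π.toLinearEquiv.toEquiv.image_setOf_apply_eq θ Neg.neg hθ (map_neg π)⟩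
end
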